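/- arXiv:2211.07824 — 7 statements merged into one kernel-verified Lean document; each statement's English description precedes it below -/
import Mathlib

section
/- Let F : ℝ → ℝ be continuous, let v, a, b ∈ ℝ, and let u, w : ℝ → ℝ be differentiable with u'(ξ) = w(ξ) and w'(ξ) = F(u(ξ)) − v for all ξ ∈ ℝ. If u(ξ) → a and w(ξ) → 0 as ξ → −∞, and u(ξ) → b and w(ξ) → 0 as ξ → +∞, then the equal area rule holds: ∫_a^b (v − F(t)) dt = 0. -/
open Filter

/-- The equal area rule: if the layer problem `u' = w`, `w' = F(u) − v` has a
heteroclinic orbit connecting `(a,0)` (as `ξ → −∞`) to `(b,0)` (as `ξ → +∞`),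
then `∫_a^b (v − F(t)) dt = 0`. -/
theorem equal_area_rule
    (F : ℝ → ℝ) (hF : Continuous F) (v a b : ℝ)
    (u w : ℝ → ℝ)
    (hu : ∀ ξ : ℝ, HasDerivAt u (w ξ) ξ)
    (hw : ∀ ξ : ℝ, HasDerivAt w (F (u ξ) - v) ξ)
    (hua : Tendsto u atBot (nhds a))
    (hwa : Tendsto w atBot (nhds 0))
    (hub : Tendsto u atTop (nhds b))
    (hwb : Tendsto w atTop (nhds 0)) :
    ∫ t in a..b, (v - F t) = 0 := by
  have hc : Continuous fun t => v - F t := continuous_const.sub hF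
  set G : ℝ → ℝ := fun x => ∫ t in a..x, (v - F t)
  have hG (x : ℝ) : HasDerivAt G (v - F x) x := (hc.integral_hasStrictDerivAt a x).hasDerivAt
  have hGc : Continuous G := continuous_iff_continuousAt.2 fun x => (hG x).continuousAt
  -- The energy is a first integral of the layer problem.
  set E : ℝ → ℝ := fun ξ => w ξ ^ 2 / 2 + G (u ξ)
  have hE (ξ : ℝ) : HasDerivAt E 0 ξ := by
    have h := (((hw ξ).pow 2).div_const 2).add ((hG (u ξ)).comp ξ (hu ξ))
    refine h.congr_deriv ?_
    push_cast
    ring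
  have hconst : E = fun _ => E 0 := funext fun ξ =>
    is_const_of_deriv_eq_zero (fun x => (hE x).differentiableAt) (fun x => (hE x).deriv) ξ 0
  have hlim {l : Filter ℝ} {c : ℝ} (hul : Tendsto u l (nhds c)) (hwl : Tendsto w l (nhds 0)) :
      Tendsto E l (nhds (G c)) := by
    simpa using ((hwl.pow 2).div_const 2).add ((hGc.tendsto c).comp hul)
  have ha := hlim hua hwa
  have hb := hlim hub hwb
  rw [hconst] at ha hb
  have hab : G b = G a :=
    (tendsto_nhds_unique hb tendsto_const_nhds).trans (tendsto_nhds_unique tendsto_const_nhds ha)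
  exact hab.trans intervalIntegral.integral_same
end

section
/- Let F(u) = 2u³ − 4u² + (21/8)u and set u₋ = (8 − √3)/12 and u₊ = (8 + √3)/12. Then F(u₋) = F(u₊), and the equal area rule holds between these values: ∫_{u₋}^{u₊} (F(u₊) − F(t)) dt = 0. -/
/-- The jump values `u± = (8 ± √3)/12` lie on the same level set of the
potential `F(u) = 2u³ − 4u² + (21/8)u`, and the equal area rule holds between
them. -/
theorem equal_area_rule_jump_values :
    (fun u : ℝ => 2*u^3 - 4*u^2 + (21/8)*u) ((8 - Real.sqrt 3)/12)
        = (fun u : ℝ => 2*u^3 - 4*u^2 + (21/8)*u) ((8 + Real.sqrt 3)/12)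
    ∧ ∫ t in ((8 - Real.sqrt 3)/12)..((8 + Real.sqrt 3)/12),
        ((fun u : ℝ => 2*u^3 - 4*u^2 + (21/8)*u) ((8 + Real.sqrt 3)/12)
          - (2*t^3 - 4*t^2 + (21/8)*t)) = 0 := by
  have h3 : Real.sqrt 3 ^ 3 = 3 * Real.sqrt 3 := by rw [pow_succ, Real.sq_sqrt (by norm_num)]
  refine ⟨by ring_nf; rw [h3]; ring, ?_⟩
  set c : ℝ := (fun u : ℝ => 2*u^3 - 4*u^2 + (21/8)*u) ((8 + Real.sqrt 3)/12) with hc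
  have hderiv : ∀ t : ℝ, HasDerivAt
      (fun t : ℝ => c * t - (t^4 / 2 - 4/3 * t^3 + 21/16 * t^2))
      (c - (2*t^3 - 4*t^2 + (21/8)*t)) t := by
    intro t
    refine HasDerivAt.congr_deriv (((hasDerivAt_id' t).const_mul c).sub
      ((((hasDerivAt_pow 4 t).div_const 2).sub ((hasDerivAt_pow 3 t).const_mul (4/3))).add
        ((hasDerivAt_pow 2 t).const_mul (21/16)))) ?_
    push_cast
    ring
  rw [intervalIntegral.integral_eq_sub_of_hasDerivAt (fun t _ => hderiv t)
    (Continuous.intervalIntegrable (by fun_prop) _ _)]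
  have hc' : c = 61/108 := by
    rw [hc]
    ring_nf
    rw [h3]
    ring
  rw [hc']
  ring
end

section
/- Let ε > 0 and c ∈ ℝ. The 4×4 real matrix M₋ with rows (0, 1, 0, 0), (21/8, 0, 0, −1), (ε, 0, 0, 0), (−εc, 0, ε, 0) — the Jacobian of the travelling-wave system u' = w, w' = F(u) − v, p' = −εR(u), v' = ε(p − cu) at the equilibrium q₋ = (0,0,0,0) — has characteristic polynomial X⁴ − (21/8)X² − εcX + ε². Moreover this polynomial has no purely imaginary complex roots, and exactly two of its complex roots, counted with multiplicity, have positive real part (hence exactly two have negative real part). -/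
open Polynomial

/-- A depressed real quartic with negative quadratic coefficient and positive constant term
splits into two real quadratics, with roots in the left and in the right half-plane. -/
theorem exists_quadratic_factors (a b e : ℝ) (ha : 0 < a) (he : 0 < e) :
    ∃ s q r : ℝ, 0 < s ∧ 0 < q ∧ 0 < r ∧ q + r - s ^ 2 = -a ∧ s * (r - q) = -b ∧
      q * r = e ^ 2 := by
  obtain ⟨t, ht, hroot⟩ : ∃ t, a ≤ t ∧ t * ((t - a) ^ 2 - 4 * e ^ 2) - b ^ 2 = 0 := by
    have hk : a ≤ a + 2 * e + (1 + b ^ 2) := by nlinarith [sq_nonneg b]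
    have hcont : ContinuousOn (fun t : ℝ => t * ((t - a) ^ 2 - 4 * e ^ 2) - b ^ 2)
        (Set.Icc a (a + 2 * e + (1 + b ^ 2))) := by fun_prop
    obtain ⟨t, ht, h⟩ := intermediate_value_Icc hk hcont (show (0 : ℝ) ∈ _ from by
      constructor
      · have : 0 ≤ a * e ^ 2 := by positivity
        have := sq_nonneg b
        nlinarith
      · have h : (a + 2 * e + (1 + b ^ 2)) *
            ((a + 2 * e + (1 + b ^ 2) - a) ^ 2 - 4 * e ^ 2) - b ^ 2 =
            (a + 2 * e + b ^ 2) * ((1 + b ^ 2) ^ 2 + 4 * e * (1 + b ^ 2)) +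
              4 * e * (1 + b ^ 2) + 1 + b ^ 2 + b ^ 4 := by ring
        rw [h]
        positivity)
    exact ⟨t, ht.1, h⟩
  have htpos : 0 < t := ha.trans_le ht
  have hs : 0 < √t := Real.sqrt_pos.2 htpos
  have hsq : √t ^ 2 = t := Real.sq_sqrt htpos.le
  have hprod : (t - a + b / √t) / 2 * ((t - a - b / √t) / 2) = e ^ 2 := by
    have h : (b / √t) ^ 2 = (t - a) ^ 2 - 4 * e ^ 2 := by
      rw [div_pow, hsq, div_eq_iff htpos.ne']
      linarith
    linarith
  have hpos : 0 < (t - a + b / √t) / 2 * ((t - a - b / √t) / 2) := by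
    rw [hprod]; positivity
  obtain ⟨hq, hr⟩ | ⟨hq, hr⟩ := pos_and_pos_or_neg_and_neg_of_mul_pos hpos
  · refine ⟨√t, _, _, hs, hq, hr, by rw [hsq]; ring, ?_, hprod⟩
    field_simp
    ring
  · linarith

/-- The roots of `X² + sX + q` with `q > 0` lie in the open half-plane opposite to `s`. -/
theorem mul_re_neg_of_quadratic_root {s q : ℝ} (hs : s ≠ 0) (hq : 0 < q) {z : ℂ}
    (hz : z ^ 2 + s * z + q = 0) : s * z.re < 0 := by
  have hre := congrArg Complex.re hz
  have him := congrArg Complex.im hz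
  simp [pow_two] at hre him
  have hs2 : 0 < s ^ 2 := by positivity
  have h : z.im * (2 * z.re + s) = 0 := by linarith
  rcases mul_eq_zero.1 h with h | h
  · rw [h] at hre
    nlinarith [sq_nonneg z.re]
  · nlinarith

theorem quadratic_monic_natDegree (s q : ℂ) :
    (X ^ 2 + C s * X + C q).Monic ∧ (X ^ 2 + C s * X + C q).natDegree = 2 :=
  ⟨by monicity!, by compute_degree!⟩

theorem card_roots_quadratic (s q : ℂ) :
    Multiset.card (X ^ 2 + C s * X + C q).roots = 2 := by
  rw [← (IsAlgClosed.splits _).natDegree_eq_card_roots, (quadratic_monic_natDegree s q).2]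

theorem mul_re_neg_of_mem_roots_quadratic {s q : ℝ} (hs : s ≠ 0) (hq : 0 < q) {z : ℂ}
    (hz : z ∈ (X ^ 2 + C (s : ℂ) * X + C (q : ℂ)).roots) : s * z.re < 0 := by
  refine mul_re_neg_of_quadratic_root hs hq ?_
  simpa using (mem_roots'.1 hz).2

open scoped Classical in
/-- The Jacobian of the travelling-wave system at the equilibrium `q₋ = (0,0,0,0)`
has characteristic polynomial `X⁴ − (21/8)X² − εcX + ε²`; this polynomial has no
purely imaginary complex roots, and exactly two of its complex roots (with
multiplicity) have positive real part and exactly two have negative real part. -/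
theorem jacobian_qminus_hyperbolic_saddle (ε c : ℝ) (hε : 0 < ε) :
    let M : Matrix (Fin 4) (Fin 4) ℝ :=
      !![0, 1, 0, 0;
         21/8, 0, 0, -1;
         ε, 0, 0, 0;
         -ε*c, 0, ε, 0]
    let p : Polynomial ℝ := X^4 - C (21/8) * X^2 - C (ε*c) * X + C (ε^2)
    M.charpoly = p
    ∧ (∀ z : ℂ, (p.map (algebraMap ℝ ℂ)).IsRoot z → z.re ≠ 0)
    ∧ Multiset.card
        (((p.map (algebraMap ℝ ℂ)).roots).filter (fun z => 0 < z.re)) = 2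
    ∧ Multiset.card
        (((p.map (algebraMap ℝ ℂ)).roots).filter (fun z => z.re < 0)) = 2 := by
  intro M p
  obtain ⟨s, q, r, hs, hq, hr, h₂, h₁, h₀⟩ :=
    exists_quadratic_factors (21 / 8) (ε * c) ε (by norm_num) hε
  have hfac : p.map (algebraMap ℝ ℂ) =
      (X ^ 2 + C (s : ℂ) * X + C (q : ℂ)) * (X ^ 2 + C ((-s : ℝ) : ℂ) * X + C (r : ℂ)) := by
    have hp : p = (X ^ 2 + C s * X + C q) * (X ^ 2 + C (-s) * X + C r) := by
      have e₂ : (C (21 / 8) : ℝ[X]) = C s ^ 2 - C q - C r := by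
        rw [← C_pow, ← C_sub, ← C_sub]; congr 1; linarith
      have e₁ : (C (ε * c) : ℝ[X]) = C s * (C q - C r) := by
        rw [← C_sub, ← C_mul]; congr 1; linarith
      have e₀ : (C (ε ^ 2) : ℝ[X]) = C q * C r := by rw [← C_mul, h₀]
      simp only [p, e₂, e₁, e₀, C_neg]
      ring
    rw [hp]
    simp
  have hne : (X ^ 2 + C (s : ℂ) * X + C (q : ℂ)) *
      (X ^ 2 + C ((-s : ℝ) : ℂ) * X + C (r : ℂ)) ≠ 0 :=
    ((quadratic_monic_natDegree _ _).1.mul (quadratic_monic_natDegree _ _).1).ne_zero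
  have hleft : ∀ z ∈ (X ^ 2 + C (s : ℂ) * X + C (q : ℂ)).roots, z.re < 0 := fun z hz => by
    have := mul_re_neg_of_mem_roots_quadratic hs.ne' hq hz
    exact (pos_iff_neg_of_mul_neg this).1 hs
  have hright : ∀ z ∈ (X ^ 2 + C ((-s : ℝ) : ℂ) * X + C (r : ℂ)).roots, 0 < z.re :=
    fun z hz => by
      have := mul_re_neg_of_mem_roots_quadratic (neg_ne_zero.2 hs.ne') hr hz
      exact (neg_iff_pos_of_mul_neg this).1 (neg_neg_of_pos hs)
  refine ⟨?_, fun z hz => ?_, ?_, ?_⟩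
  · simp only [M, p, Matrix.charpoly, Matrix.charmatrix]
    simp [Matrix.det_succ_row_zero, Fin.sum_univ_succ, Fin.succAbove]
    ring
  · rw [hfac] at hz
    have hmem := (mem_roots hne).2 hz
    rw [roots_mul hne, Multiset.mem_add] at hmem
    exact hmem.elim (fun h => (hleft z h).ne) (fun h => (hright z h).ne')
  · rw [hfac, roots_mul hne, Multiset.filter_add,
      Multiset.filter_eq_nil.2 fun z hz => (hleft z hz).not_gt,
      Multiset.filter_eq_self.2 hright, zero_add, card_roots_quadratic]
  · rw [hfac, roots_mul hne, Multiset.filter_add, Multiset.filter_eq_self.2 hleft,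
      Multiset.filter_eq_nil.2 fun z hz => (hright z hz).not_gt, add_zero,
      card_roots_quadratic]
end

section
/- Let ε > 0 and c ∈ ℝ. The 4×4 real matrix M₊ with rows (0, 1, 0, 0), (5/8, 0, 0, −1), (4ε, 0, 0, 0), (−εc, 0, ε, 0) — the Jacobian of the travelling-wave system u' = w, w' = F(u) − v, p' = −εR(u), v' = ε(p − cu) at the equilibrium q₊ = (1, 0, c, 5/8) — has characteristic polynomial X⁴ − (5/8)X² − εcX + 4ε². Moreover this polynomial has no purely imaginary complex roots, and exactly two of its complex roots, counted with multiplicity, have positive real part (hence exactly two have negative real part). -/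
open Polynomial

/-- Four nonzero complex numbers closed under conjugation, exactly one of which lies in the open
right half-plane and three in the open left half-plane, cannot have a positive product. -/
lemma not_pos_prod_of_one_pos_re_of_three_neg_re {a b c d : ℂ} {r : ℝ} (hr : 0 < r)
    (hconj : ∀ z, z = a ∨ z = b ∨ z = c ∨ z = d →
      starRingEnd ℂ z = a ∨ starRingEnd ℂ z = b ∨ starRingEnd ℂ z = c ∨ starRingEnd ℂ z = d)
    (hprod : a * b * c * d = r)
    (ha : 0 < a.re) (hb : b.re < 0) (hc : c.re < 0) (hd : d.re < 0) : False := by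
  have conj_ne {x y : ℂ} (hx : x.re < 0) (hy : 0 < y.re) : starRingEnd ℂ x ≠ y := by
    rintro rfl
    rw [Complex.conj_re] at hy
    linarith
  have conj_ne' {x y : ℂ} (hx : x.re < 0) (hy : 0 < y.re) : starRingEnd ℂ y ≠ x := by
    rintro rfl
    rw [Complex.conj_re] at hx
    linarith
  have ha_im : a.im = 0 := by
    have h := hconj a (by simp)
    simp only [conj_ne' hb ha, conj_ne' hc ha, conj_ne' hd ha, or_false] at h
    exact Complex.conj_eq_iff_im.mp h
  have haR : a = (a.re : ℂ) := Complex.ext rfl (by simp [ha_im])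
  have pair {x y : ℂ} (hx : x.re < 0) (hy : y.re < 0)
      (hxy : a * (x * starRingEnd ℂ x) * y = r) : False := by
    rw [haR, Complex.mul_conj, ← Complex.ofReal_mul] at hxy
    have h := congrArg Complex.re hxy
    rw [Complex.re_ofReal_mul, Complex.ofReal_re] at h
    have : 0 ≤ a.re * Complex.normSq x := mul_nonneg ha.le (Complex.normSq_nonneg x)
    nlinarith
  have hb' := hconj b (by simp)
  have hc' := hconj c (by simp)
  simp only [conj_ne hb ha, conj_ne hc ha, false_or] at hb' hc'
  have hbc : starRingEnd ℂ b ≠ c := fun h => pair hb hd (by rw [h, ← hprod]; ring)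
  have hbd : starRingEnd ℂ b ≠ d := fun h => pair hb hc (by rw [h, ← hprod]; ring)
  have hcb : starRingEnd ℂ c ≠ b := fun h => pair hc hd (by rw [h, ← hprod]; ring)
  have hcd : starRingEnd ℂ c ≠ d := fun h => pair hc hb (by rw [h, ← hprod]; ring)
  simp only [hbc, hbd, hcb, hcd, or_false, false_or] at hb' hc'
  have hbR : b = (b.re : ℂ) := (Complex.conj_eq_iff_re.mp hb').symm
  have hcR : c = (c.re : ℂ) := (Complex.conj_eq_iff_re.mp hc').symm
  rw [haR, hbR, hcR, ← Complex.ofReal_mul, ← Complex.ofReal_mul] at hprod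
  have h := congrArg Complex.re hprod
  rw [Complex.re_ofReal_mul, Complex.ofReal_re] at h
  have := mul_pos ha (mul_pos_of_neg_of_neg hb hc)
  nlinarith

open scoped Classical in
/-- Four complex numbers off the imaginary axis, closed under conjugation, with zero sum and
positive product, split evenly between the two open half-planes. -/
lemma card_filter_re_of_sum_eq_zero_of_prod_pos {a b c d : ℂ} {r : ℝ} (hr : 0 < r)
    (hconj : ∀ z, z = a ∨ z = b ∨ z = c ∨ z = d →
      starRingEnd ℂ z = a ∨ starRingEnd ℂ z = b ∨ starRingEnd ℂ z = c ∨ starRingEnd ℂ z = d)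
    (hsum : a + b + c + d = 0) (hprod : a * b * c * d = r)
    (ha : a.re ≠ 0) (hb : b.re ≠ 0) (hc : c.re ≠ 0) (hd : d.re ≠ 0) :
    Multiset.card (Multiset.filter (fun z : ℂ => 0 < z.re) {a, b, c, d}) = 2 ∧
    Multiset.card (Multiset.filter (fun z : ℂ => z.re < 0) {a, b, c, d}) = 2 := by
  have hre : a.re + b.re + c.re + d.re = 0 := by simpa using congrArg Complex.re hsum
  have one_pos {x y z w : ℂ}
      (hmem : ∀ t, t = x ∨ t = y ∨ t = z ∨ t = w ↔ t = a ∨ t = b ∨ t = c ∨ t = d)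
      (hp : x * y * z * w = a * b * c * d)
      (hx : 0 < x.re) (hy : y.re < 0) (hz : z.re < 0) (hw : w.re < 0) : False :=
    not_pos_prod_of_one_pos_re_of_three_neg_re hr
      (fun t ht => (hmem _).2 (hconj t ((hmem t).1 ht))) (hp.trans hprod) hx hy hz hw
  have one_neg {x y z w : ℂ}
      (hmem : ∀ t, t = x ∨ t = y ∨ t = z ∨ t = w ↔ t = a ∨ t = b ∨ t = c ∨ t = d)
      (hp : x * y * z * w = a * b * c * d)
      (hx : x.re < 0) (hy : 0 < y.re) (hz : 0 < z.re) (hw : 0 < w.re) : False := by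
    refine not_pos_prod_of_one_pos_re_of_three_neg_re (a := -x) (b := -y) (c := -z) (d := -w) hr
      (fun t ht => ?_) (by rw [← hprod, ← hp]; ring) (by simpa) (by simpa) (by simpa) (by simpa)
    have h := (hmem _).2 (hconj (-t) ((hmem _).1 (by simpa only [neg_eq_iff_eq_neg] using ht)))
    simpa only [map_neg, neg_eq_iff_eq_neg] using h
  rcases lt_or_gt_of_ne ha with ha | ha <;> rcases lt_or_gt_of_ne hb with hb | hb <;>
  rcases lt_or_gt_of_ne hc with hc | hc <;> rcases lt_or_gt_of_ne hd with hd | hd <;>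
  first
  | (exfalso; linarith)
  | exact (one_pos (fun _ => Iff.rfl) (by ring) ha hb hc hd).elim
  | exact (one_pos (fun t => by simp only [or_comm, or_left_comm]) (by ring) hb ha hc hd).elim
  | exact (one_pos (fun t => by simp only [or_comm, or_left_comm]) (by ring) hc ha hb hd).elim
  | exact (one_pos (fun t => by simp only [or_comm, or_left_comm]) (by ring) hd ha hb hc).elim
  | exact (one_neg (fun _ => Iff.rfl) (by ring) ha hb hc hd).elim
  | exact (one_neg (fun t => by simp only [or_left_comm]) (by ring) hb ha hc hd).elim
  | exact (one_neg (fun t => by simp only [or_left_comm]) (by ring) hc ha hb hd).elim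
  | exact (one_neg (fun t => by simp only [or_comm, or_left_comm]) (by ring) hd ha hb hc).elim
  | simp [Multiset.insert_eq_cons, Multiset.filter_singleton,
      ha, hb, hc, hd, ha.not_gt, hb.not_gt, hc.not_gt, hd.not_gt]

open scoped Classical in
/-- The Jacobian of the travelling-wave system at the equilibrium
`q₊ = (1, 0, c, 5/8)` has characteristic polynomial `X⁴ − (5/8)X² − εcX + 4ε²`;
this polynomial has no purely imaginary complex roots, and exactly two of its
complex roots (with multiplicity) have positive real part and exactly two have
negative real part. -/
theorem jacobian_qplus_hyperbolic_saddle (ε c : ℝ) (hε : 0 < ε) :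
    let M : Matrix (Fin 4) (Fin 4) ℝ :=
      !![0, 1, 0, 0;
         5/8, 0, 0, -1;
         4*ε, 0, 0, 0;
         -ε*c, 0, ε, 0]
    let p : Polynomial ℝ := X^4 - C (5/8) * X^2 - C (ε*c) * X + C (4*ε^2)
    M.charpoly = p
    ∧ (∀ z : ℂ, (p.map (algebraMap ℝ ℂ)).IsRoot z → z.re ≠ 0)
    ∧ Multiset.card
        (((p.map (algebraMap ℝ ℂ)).roots).filter (fun z => 0 < z.re)) = 2
    ∧ Multiset.card
        (((p.map (algebraMap ℝ ℂ)).roots).filter (fun z => z.re < 0)) = 2 := by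
  intro M p
  set q : Polynomial ℂ := p.map (algebraMap ℝ ℂ) with hq
  have hq' : q = X^4 - C (5/8) * X^2 - C ((ε : ℂ)*c) * X + C (4*(ε : ℂ)^2) := by
    simp [hq, p]
  have hroot (z : ℂ) : q.IsRoot z ↔ z^4 - 5/8 * z^2 - ε*c*z + 4*ε^2 = 0 := by
    simp [hq', IsRoot.def]
  have hre (z : ℂ) (hz : q.IsRoot z) : z.re ≠ 0 := by
    intro h0
    have hzI : z = z.im * Complex.I := Complex.ext (by simp [h0]) (by simp)
    have h := (hroot z).1 hz
    have h4 : Complex.I ^ 4 = 1 := Complex.I_pow_four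
    rw [hzI] at h
    have h' : ((z.im^4 + 5/8 * z.im^2 + 4*ε^2 : ℝ) : ℂ)
        + ((-(ε*c*z.im) : ℝ) : ℂ) * Complex.I = 0 := by
      push_cast
      linear_combination h - (z.im : ℂ)^4 * h4 + 5/8 * (z.im : ℂ)^2 * Complex.I_sq
    have h'' := congrArg Complex.re h'
    rw [Complex.add_re, Complex.ofReal_re, Complex.re_ofReal_mul, Complex.I_re, mul_zero,
      add_zero, Complex.zero_re] at h''
    have : 0 < z.im^4 + 5/8 * z.im^2 + 4*ε^2 := by positivity
    linarith
  have hconj (z : ℂ) (hz : q.IsRoot z) : q.IsRoot (starRingEnd ℂ z) := by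
    rw [hroot] at hz ⊢
    simpa [map_ofNat] using congrArg (starRingEnd ℂ) hz
  have hdeg : q.natDegree = 4 := by rw [hq']; compute_degree!
  have hmonic : q.Monic := by rw [hq']; monicity!
  have hsplit : q.Splits := IsAlgClosed.splits q
  have hcard : q.roots.card = 4 := by rw [← hdeg, hsplit.natDegree_eq_card_roots]
  refine ⟨?_, hre, ?_⟩
  · simp only [M, p, Matrix.charpoly, Matrix.det_succ_row_zero, Fin.sum_univ_succ]
    simp [Matrix.charmatrix_apply, Fin.succAbove, Matrix.submatrix]
    ring
  · obtain ⟨x, y, z, w, hs⟩ := Multiset.card_eq_four.1 hcard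
    have hmem (t : ℂ) : q.IsRoot t ↔ t = x ∨ t = y ∨ t = z ∨ t = w := by
      rw [← mem_roots hmonic.ne_zero, hs]
      simp
    have hsum : x + y + z + w = 0 := by
      have h := hsplit.nextCoeff_eq_neg_sum_roots_of_monic hmonic
      have hnext : q.nextCoeff = 0 := by
        rw [nextCoeff_of_natDegree_pos (by omega), hdeg, hq']
        simp [-map_mul, -map_pow]
      rw [hnext, hs] at h
      simpa [Multiset.insert_eq_cons, add_assoc] using (neg_eq_zero.1 h.symm)
    have hprod : x * y * z * w = ((4*ε^2 : ℝ) : ℂ) := by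
      have h := hsplit.eval_eq_prod_roots 0
      rw [hmonic.leadingCoeff, hs, hq'] at h
      simp [Multiset.insert_eq_cons] at h
      push_cast
      linear_combination -h
    rw [hs]
    exact card_filter_re_of_sum_eq_zero_of_prod_pos (by positivity)
      (fun t ht => (hmem _).1 (hconj t ((hmem t).2 ht))) hsum hprod
      (hre x ((hmem x).2 (by simp))) (hre y ((hmem y).2 (by simp)))
      (hre z ((hmem z).2 (by simp))) (hre w ((hmem w).2 (by simp)))
end

section
/- Let ε > 0, c ∈ ℝ, and λ ∈ ℂ with Re λ > −1. Then the polynomial ε²X⁴ − (35/12)X² − cX + (λ + 1) ∈ ℂ[X] has no purely imaginary roots, and exactly two of its roots, counted with multiplicity, have positive real part (hence exactly two have negative real part). -/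
open Polynomial

open Filter Topology in
/-- Along the imaginary axis, `iy - z` has a continuous phase whose total increment is `π` when
`Re z < 0` and `-π` when `Re z > 0`. -/
theorem exists_continuous_phase_sub (z : ℂ) (hz : z.re ≠ 0) :
    ∃ (Θ : ℝ → ℝ) (t b : ℝ), Continuous Θ ∧ Tendsto Θ atTop (𝓝 t) ∧ Tendsto Θ atBot (𝓝 b) ∧
      t - b = (if z.re < 0 then Real.pi else -Real.pi) ∧
      ∀ y : ℝ, ∃ r : ℝ, 0 < r ∧ (y * Complex.I - z : ℂ) = r * Complex.exp (Θ y * Complex.I) := by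
  have polar (x u : ℝ) (hx : x ≠ 0) : (x + u * Complex.I : ℂ) =
      ((x * √(1 + (u / x) ^ 2) : ℝ) : ℂ) * Complex.exp (Real.arctan (u / x) * Complex.I) := by
    have hs : √(1 + (u / x) ^ 2) ≠ 0 := by positivity
    rw [Complex.exp_mul_I, ← Complex.ofReal_cos, ← Complex.ofReal_sin, Real.cos_arctan,
      Real.sin_arctan]
    apply Complex.ext
    · simp
      field_simp
    · simp
      field_simp
  have split (y : ℝ) :
      (y * Complex.I - z : ℂ) = ((-z.re : ℝ) : ℂ) + ((y - z.im : ℝ) : ℂ) * Complex.I := by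
    apply Complex.ext <;> simp
  have top : Tendsto (fun y : ℝ => y - z.im) atTop atTop :=
    tendsto_atTop_add_const_right _ _ tendsto_id
  have bot : Tendsto (fun y : ℝ => y - z.im) atBot atBot :=
    tendsto_atBot_add_const_right _ _ tendsto_id
  have arctan_top := Real.tendsto_arctan_atTop.mono_right (nhdsWithin_le_nhds (s := Set.Iio _))
  have arctan_bot := Real.tendsto_arctan_atBot.mono_right (nhdsWithin_le_nhds (s := Set.Ioi _))
  have cont : Continuous fun y : ℝ => Real.arctan ((y - z.im) / -z.re) := by fun_prop
  rcases hz.lt_or_gt with h | h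
  · have hx : 0 < -z.re := by linarith
    refine ⟨_, Real.pi / 2, -(Real.pi / 2), cont,
      arctan_top.comp (top.atTop_div_const hx), arctan_bot.comp (bot.atBot_div_const hx), ?_,
      fun y => ⟨-z.re * √(1 + ((y - z.im) / -z.re) ^ 2), by positivity, ?_⟩⟩
    · rw [if_pos h]; ring
    · rw [split, polar _ _ hx.ne']
  · have hx : -z.re < 0 := by linarith
    refine ⟨fun y => Real.pi + Real.arctan ((y - z.im) / -z.re), Real.pi + -(Real.pi / 2),
      Real.pi + Real.pi / 2, continuous_const.add cont,
      (arctan_bot.comp (top.atTop_div_const_of_neg hx)).const_add _,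
      (arctan_top.comp ((tendsto_div_const_atTop_of_neg hx).2 bot)).const_add _, ?_,
      fun y => ⟨z.re * √(1 + ((y - z.im) / -z.re) ^ 2), by positivity, ?_⟩⟩
    · rw [if_neg h.not_gt]; ring
    · rw [split, polar _ _ hx.ne]
      push_cast
      rw [add_mul, Complex.exp_add, Complex.exp_pi_mul_I]
      ring

open Filter Topology in
open scoped Classical in
/-- The total phase increment of `∏ (iy - z)` along the imaginary axis counts the points with
negative real part minus those with positive real part. -/
theorem exists_continuous_phase_prod (s : Multiset ℂ) (hs : ∀ z ∈ s, z.re ≠ 0) :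
    ∃ (Θ : ℝ → ℝ) (t b : ℝ), Continuous Θ ∧ Tendsto Θ atTop (𝓝 t) ∧ Tendsto Θ atBot (𝓝 b) ∧
      t - b = ((Multiset.card (s.filter fun z => z.re < 0) : ℝ) -
        Multiset.card (s.filter fun z => 0 < z.re)) * Real.pi ∧
      ∀ y : ℝ, ∃ r : ℝ, 0 < r ∧
        (s.map fun z => (y * Complex.I - z : ℂ)).prod = r * Complex.exp (Θ y * Complex.I) := by
  induction s using Multiset.induction_on with
  | empty =>
    exact ⟨fun _ => 0, 0, 0, continuous_const, tendsto_const_nhds, tendsto_const_nhds, by simp,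
      fun y => ⟨1, one_pos, by simp⟩⟩
  | cons z s ih =>
    obtain ⟨Θ, t, b, hc, ht, hb, htb, hr⟩ := ih fun w hw => hs w (Multiset.mem_cons_of_mem hw)
    have hz := hs z (Multiset.mem_cons_self z s)
    obtain ⟨Θ', t', b', hc', ht', hb', htb', hr'⟩ := exists_continuous_phase_sub z hz
    refine ⟨_, _, _, hc'.add hc, ht'.add ht, hb'.add hb, ?_, fun y => ?_⟩
    · rw [add_sub_add_comm, htb, htb']
      rcases hz.lt_or_gt with h | h
      · rw [if_pos h, Multiset.filter_cons_of_pos (p := fun z : ℂ => z.re < 0) _ h,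
          Multiset.filter_cons_of_neg (p := fun z : ℂ => 0 < z.re) _ h.not_gt, Multiset.card_cons]
        push_cast; ring
      · rw [if_neg h.not_gt,
          Multiset.filter_cons_of_neg (p := fun z : ℂ => z.re < 0) _ h.not_gt,
          Multiset.filter_cons_of_pos (p := fun z : ℂ => 0 < z.re) _ h, Multiset.card_cons]
        push_cast; ring
    · obtain ⟨r, hr0, hr⟩ := hr y
      obtain ⟨r', hr0', hr'⟩ := hr' y
      refine ⟨r' * r, by positivity, ?_⟩
      rw [Multiset.map_cons, Multiset.prod_cons, hr, hr']
      rw [Pi.add_apply]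
      push_cast
      rw [add_mul, Complex.exp_add]
      ring

/-- A continuous phase along which the cosine stays positive varies by less than `π`. -/
theorem sub_lt_pi_of_cos_pos {Θ : ℝ → ℝ} (hc : Continuous Θ) (hpos : ∀ y, 0 < Real.cos (Θ y))
    (x y : ℝ) : Θ y - Θ x < Real.pi := by
  by_contra! h
  obtain ⟨w, hw⟩ := mem_range_of_exists_le_of_exists_ge hc
    (c := Θ x + Real.pi) ⟨x, by linarith [Real.pi_pos]⟩ ⟨y, by linarith⟩
  have h₁ := hpos w
  rw [hw, Real.cos_add_pi] at h₁
  linarith [hpos x]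

open scoped Classical in
/-- If `∏ (iy - z)` has positive real part for all real `y`, then the numbers of points in the two
open half-planes differ by at most one. -/
theorem abs_card_sub_card_le_one (s : Multiset ℂ) (hs : ∀ z ∈ s, z.re ≠ 0)
    (hpos : ∀ y : ℝ, 0 < ((s.map fun z => (y * Complex.I - z : ℂ)).prod).re) :
    |(Multiset.card (s.filter fun z => z.re < 0) : ℤ) -
      Multiset.card (s.filter fun z => 0 < z.re)| ≤ 1 := by
  obtain ⟨Θ, t, b, hc, ht, hb, htb, hr⟩ := exists_continuous_phase_prod s hs
  have hcos (y : ℝ) : 0 < Real.cos (Θ y) := by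
    obtain ⟨r, hr0, hr⟩ := hr y
    have h := hpos y
    rw [hr, Complex.re_ofReal_mul, Complex.exp_ofReal_mul_I_re] at h
    exact pos_of_mul_pos_right h hr0.le
  have hlt := sub_lt_pi_of_cos_pos hc hcos
  have upper (x : ℝ) : t - Θ x ≤ Real.pi :=
    le_of_tendsto' (ht.sub_const _) fun y => (hlt x y).le
  have lower (x : ℝ) : Θ x - t ≤ Real.pi :=
    le_of_tendsto' (ht.const_sub _) fun y => (hlt y x).le
  have h₁ : t - b ≤ Real.pi := le_of_tendsto' (hb.const_sub _) upper
  have h₂ : b - t ≤ Real.pi := le_of_tendsto' (hb.sub_const _) lower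
  rw [← neg_sub t b] at h₂
  rw [htb] at h₁ h₂
  have hpi := Real.pi_pos
  rw [abs_le]
  constructor
  · have : (-1 : ℝ) ≤ (Multiset.card (s.filter fun z => z.re < 0) : ℝ) -
        Multiset.card (s.filter fun z => 0 < z.re) := by nlinarith
    exact_mod_cast this
  · have : (Multiset.card (s.filter fun z => z.re < 0) : ℝ) -
        Multiset.card (s.filter fun z => 0 < z.re) ≤ 1 := by nlinarith
    exact_mod_cast this

open scoped Classical in
/-- For `λ` with `Re λ > −1`, the characteristic polynomial
`ε²X⁴ − (35/12)X² − cX + (λ+1)` of the asymptotic matrix `A₋(λ,ε)` has no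
purely imaginary roots, and exactly two roots (counted with multiplicity) of
positive real part and two of negative real part. -/
theorem aminus_hyperbolic_signature (ε c : ℝ) (hε : 0 < ε)
    (lam : ℂ) (hlam : -1 < lam.re) :
    let p : Polynomial ℂ :=
      C ((ε : ℂ)^2) * X^4 - C (35/12) * X^2 - C (c : ℂ) * X + C (lam + 1)
    (∀ z : ℂ, z.re = 0 → ¬ p.IsRoot z)
    ∧ Multiset.card (p.roots.filter (fun z => 0 < z.re)) = 2
    ∧ Multiset.card (p.roots.filter (fun z => z.re < 0)) = 2 := by
  intro p
  have hε2 : (ε : ℂ) ^ 2 ≠ 0 := by exact_mod_cast (pow_pos hε 2).ne'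
  have hdeg : p.natDegree = 4 := by
    simp only [p]
    compute_degree!
    exact hε.ne'
  have hlead : p.leadingCoeff = ((ε ^ 2 : ℝ) : ℂ) := by
    rw [leadingCoeff, hdeg]
    simp only [p, coeff_add, coeff_sub, coeff_C_mul, coeff_X_pow, coeff_X, coeff_C]
    norm_num
  have hre (y : ℝ) : 0 < (p.eval (y * Complex.I)).re := by
    have h : p.eval (y * Complex.I) =
        ((ε ^ 2 * y ^ 4 + 35 / 12 * y ^ 2 : ℝ) : ℂ) + (lam + 1) - (c * y : ℝ) * Complex.I := by
      simp only [p, eval_add, eval_sub, eval_mul, eval_C, eval_pow, eval_X, mul_pow,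
        Complex.I_sq, Complex.I_pow_four]
      push_cast
      ring
    rw [h, Complex.sub_re, Complex.add_re, Complex.ofReal_re, Complex.re_ofReal_mul,
      Complex.I_re, Complex.add_re, Complex.one_re]
    have : 0 ≤ ε ^ 2 * y ^ 4 + 35 / 12 * y ^ 2 := by positivity
    linarith
  have himag (z : ℂ) (hz : z.re = 0) : ¬ p.IsRoot z := by
    intro h
    have hzi : z = z.im * Complex.I := by apply Complex.ext <;> simp [hz]
    have := hre z.im
    rw [← hzi, h.eq_zero] at this
    simp at this
  have hne : ∀ z ∈ p.roots, z.re ≠ 0 := fun z hz h => himag z h (isRoot_of_mem_roots hz)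
  have hsplit : p.Splits := IsAlgClosed.splits p
  have hcard : Multiset.card p.roots = 4 := by rw [← hdeg, hsplit.natDegree_eq_card_roots]
  have hpos (y : ℝ) : 0 < ((p.roots.map fun z => (y * Complex.I - z : ℂ)).prod).re := by
    have h := hre y
    rw [hsplit.eval_eq_prod_roots, hlead, Complex.re_ofReal_mul] at h
    exact pos_of_mul_pos_right h (sq_nonneg ε)
  have hdiff := abs_le.mp (abs_card_sub_card_le_one p.roots hne hpos)
  have hsum : Multiset.card (p.roots.filter fun z => 0 < z.re) +
      Multiset.card (p.roots.filter fun z => z.re < 0) = 4 := by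
    rw [← hcard, ← Multiset.card_add]
    conv_rhs => rw [← Multiset.filter_add_not (fun z : ℂ => 0 < z.re) p.roots]
    congr 2
    refine Multiset.filter_congr fun z hz => ?_
    exact ⟨fun h => h.not_gt, fun h => lt_of_le_of_ne (not_lt.mp h) (hne z hz)⟩
  refine ⟨himag, ?_, ?_⟩ <;> omega
end

section
/- Let ε > 0, c ∈ ℝ, and λ ∈ ℂ with Re λ > −4. Then the polynomial ε²X⁴ − (5/12)X² − cX + (λ + 4) ∈ ℂ[X] has no purely imaginary roots, and exactly two of its roots, counted with multiplicity, have positive real part (hence exactly two have negative real part). -/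
open Polynomial

/-- A continuous argument of `y ↦ i y - r` (up to sign) for `r` off the imaginary axis. -/
lemma exists_arg_factor {r : ℂ} (hr : r.re ≠ 0) (y : ℝ) :
    ∃ ρ : ℝ, 0 < ρ ∧ Complex.I * y - r =
      ((-r.re * ρ : ℝ) : ℂ) * Complex.exp (Real.arctan ((y - r.im) / -r.re) * Complex.I) := by
  set t := (y - r.im) / -r.re with ht
  have hcos : 0 < Real.cos (Real.arctan t) := Real.cos_arctan_pos t
  have hmul : -r.re * t = y - r.im := by rw [ht]; field_simp
  have hsin : Real.sin (Real.arctan t) = t * Real.cos (Real.arctan t) := by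
    rw [← Real.tan_mul_cos hcos.ne', Real.tan_arctan]
  refine ⟨(Real.cos (Real.arctan t))⁻¹, inv_pos.2 hcos, ?_⟩
  apply Complex.ext
  · rw [Complex.re_ofReal_mul, Complex.exp_ofReal_mul_I_re]
    simp [hcos.ne']
  · rw [Complex.im_ofReal_mul, Complex.exp_ofReal_mul_I_im, hsin]
    have : -r.re * (Real.cos (Real.arctan t))⁻¹ * (t * Real.cos (Real.arctan t)) = -r.re * t := by
      field_simp
    rw [this, hmul]
    simp

open Filter Topology in
open scoped Classical in
/-- A continuous argument along the imaginary axis of a monic polynomial without imaginary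
roots, together with its limits at both ends. -/
lemma exists_continuous_arg_prod (s : Multiset ℂ) (hs : ∀ r ∈ s, r.re ≠ 0) :
    ∃ θ : ℝ → ℝ, Continuous θ ∧
      Tendsto θ atTop (𝓝 (((Multiset.card (s.filter fun z => z.re < 0) : ℝ) -
        Multiset.card (s.filter fun z => 0 < z.re)) * (Real.pi / 2))) ∧
      Tendsto θ atBot (𝓝 (-(((Multiset.card (s.filter fun z => z.re < 0) : ℝ) -
        Multiset.card (s.filter fun z => 0 < z.re)) * (Real.pi / 2)))) ∧
      ∀ y : ℝ, ∃ ρ : ℝ, 0 < ρ ∧ (s.map fun r => Complex.I * y - r).prod =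
        (((-1) ^ Multiset.card (s.filter fun z => 0 < z.re) * ρ : ℝ) : ℂ) *
          Complex.exp (θ y * Complex.I) := by
  induction s using Multiset.induction_on with
  | empty =>
    exact ⟨fun _ => 0, continuous_const, by simp, by simp, fun y => ⟨1, one_pos, by simp⟩⟩
  | cons r s ih =>
    obtain ⟨θ, hc, htop, hbot, hprod⟩ := ih fun z hz => hs z (Multiset.mem_cons_of_mem hz)
    have hr := hs r (Multiset.mem_cons_self r s)
    have harctan_top := Real.tendsto_arctan_atTop.mono_right nhdsWithin_le_nhds
    have harctan_bot := Real.tendsto_arctan_atBot.mono_right nhdsWithin_le_nhds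
    have sub_top : Tendsto (fun y : ℝ => y - r.im) atTop atTop :=
      tendsto_atTop_add_const_right _ _ tendsto_id
    have sub_bot : Tendsto (fun y : ℝ => y - r.im) atBot atBot :=
      tendsto_atBot_add_const_right _ _ tendsto_id
    refine ⟨fun y => Real.arctan ((y - r.im) / -r.re) + θ y, by fun_prop, ?_⟩
    rcases lt_or_gt_of_ne hr with h | h
    · rw [Multiset.filter_cons_of_pos (p := fun z : ℂ => z.re < 0) s h,
        Multiset.filter_cons_of_neg (p := fun z : ℂ => 0 < z.re) s h.not_gt, Multiset.card_cons]
      refine ⟨?_, ?_, fun y => ?_⟩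
      · convert (harctan_top.comp (sub_top.atTop_div_const (neg_pos.2 h))).add htop using 2
        · rfl
        · push_cast; ring
      · convert (harctan_bot.comp (sub_bot.atBot_div_const (neg_pos.2 h))).add hbot using 2
        · rfl
        · push_cast; ring
      · obtain ⟨ρ, hρ, e⟩ := hprod y
        obtain ⟨σ, hσ, e'⟩ := exists_arg_factor hr y
        refine ⟨-r.re * σ * ρ, mul_pos (mul_pos (neg_pos.2 h) hσ) hρ, ?_⟩
        rw [Multiset.map_cons, Multiset.prod_cons, e, e', Complex.ofReal_add, add_mul,
          Complex.exp_add]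
        push_cast; ring
    · rw [Multiset.filter_cons_of_neg (p := fun z : ℂ => z.re < 0) s h.not_gt,
        Multiset.filter_cons_of_pos (p := fun z : ℂ => 0 < z.re) s h, Multiset.card_cons]
      refine ⟨?_, ?_, fun y => ?_⟩
      · convert (harctan_bot.comp (sub_top.atTop_div_const_of_neg (neg_lt_zero.2 h))).add htop
          using 2
        · rfl
        · push_cast; ring
      · convert (harctan_top.comp
          (sub_bot.atBot_mul_const_of_neg (inv_lt_zero.2 (neg_lt_zero.2 h)))).add hbot using 2
        · rfl
        · push_cast; ring
      · obtain ⟨ρ, hρ, e⟩ := hprod y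
        obtain ⟨σ, hσ, e'⟩ := exists_arg_factor hr y
        refine ⟨r.re * σ * ρ, mul_pos (mul_pos h hσ) hρ, ?_⟩
        rw [Multiset.map_cons, Multiset.prod_cons, e, e', Complex.ofReal_add, add_mul,
          Complex.exp_add]
        push_cast; ring

open Filter Topology in
/-- A continuous function with limits `±L` at `±∞` takes every value strictly between them. -/
lemma Continuous.exists_eq_of_tendsto_neg {θ : ℝ → ℝ} {L v : ℝ} (hc : Continuous θ)
    (htop : Tendsto θ atTop (𝓝 L)) (hbot : Tendsto θ atBot (𝓝 (-L))) (hv : |v| < |L|) :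
    ∃ y, θ y = v := by
  rw [abs_lt] at hv
  rcases le_total 0 L with h | h
  · rw [abs_of_nonneg h] at hv
    exact mem_range_of_exists_le_of_exists_ge hc
      ((hbot.eventually_lt_const hv.1).exists.imp fun _ => le_of_lt)
      ((htop.eventually_const_lt hv.2).exists.imp fun _ => le_of_lt)
  · rw [abs_of_nonpos h, neg_neg] at hv
    exact mem_range_of_exists_le_of_exists_ge hc
      ((htop.eventually_lt_const hv.1).exists.imp fun _ => le_of_lt)
      ((hbot.eventually_const_lt hv.2).exists.imp fun _ => le_of_lt)

open scoped Classical in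
/-- Four points off the imaginary axis split evenly between the two half-planes if the monic
quartic with these roots has positive real part along the imaginary axis. -/
lemma card_filter_re_of_re_prod_pos {s : Multiset ℂ} (hcard : Multiset.card s = 4)
    (hs : ∀ r ∈ s, r.re ≠ 0)
    (hpos : ∀ y : ℝ, 0 < (s.map fun r => Complex.I * y - r).prod.re) :
    Multiset.card (s.filter fun z => 0 < z.re) = 2 ∧
      Multiset.card (s.filter fun z => z.re < 0) = 2 := by
  obtain ⟨θ, hc, htop, hbot, hprod⟩ := exists_continuous_arg_prod s hs
  have hsum : Multiset.card (s.filter fun z => 0 < z.re) +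
      Multiset.card (s.filter fun z => z.re < 0) = 4 := by
    rw [Multiset.filter_congr (p := fun z : ℂ => z.re < 0) (q := fun z : ℂ => ¬0 < z.re)
      fun z hz => by rw [not_lt, le_iff_lt_or_eq, or_iff_left (hs z hz)],
      ← Multiset.card_add, Multiset.filter_add_not, hcard]
  generalize Multiset.card (s.filter fun z => 0 < z.re) = P at *
  generalize Multiset.card (s.filter fun z => z.re < 0) = N at *
  have hcos : ∀ y, 0 < (-1 : ℝ) ^ P * Real.cos (θ y) := fun y => by
    obtain ⟨ρ, hρ, e⟩ := hprod y
    have h := hpos y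
    rw [e, Complex.re_ofReal_mul, Complex.exp_ofReal_mul_I_re, mul_right_comm] at h
    exact pos_of_mul_pos_left h hρ.le
  have hL : ∀ v, |v| < |((N : ℝ) - P) * (Real.pi / 2)| → 0 < (-1 : ℝ) ^ P * Real.cos v := by
    intro v hv
    obtain ⟨y, rfl⟩ := hc.exists_eq_of_tendsto_neg htop hbot hv
    exact hcos y
  have hpi := Real.pi_pos
  obtain rfl : N = 4 - P := by omega
  have hP : P ≤ 4 := by omega
  interval_cases P
  · have := hL Real.pi (by
      rw [abs_of_pos hpi]; exact lt_of_lt_of_le (by norm_num; linarith) (le_abs_self _))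
    norm_num at this
  · have := hL 0 (by
      rw [abs_zero]; exact lt_of_lt_of_le (by norm_num; linarith) (le_abs_self _))
    norm_num at this
  · exact ⟨rfl, rfl⟩
  · have := hL 0 (by
      rw [abs_zero]; exact lt_of_lt_of_le (by norm_num; linarith) (neg_le_abs _))
    norm_num at this
  · have := hL Real.pi (by
      rw [abs_of_pos hpi]; exact lt_of_lt_of_le (by norm_num; linarith) (neg_le_abs _))
    norm_num at this

open scoped Classical in
/-- For `λ` with `Re λ > −4`, the characteristic polynomial
`ε²X⁴ − (5/12)X² − cX + (λ+4)` of the asymptotic matrix `A₊(λ,ε)` has no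
purely imaginary roots, and exactly two roots (counted with multiplicity) of
positive real part and two of negative real part. -/
theorem aplus_hyperbolic_signature (ε c : ℝ) (hε : 0 < ε)
    (lam : ℂ) (hlam : -4 < lam.re) :
    let p : Polynomial ℂ :=
      C ((ε : ℂ)^2) * X^4 - C (5/12) * X^2 - C (c : ℂ) * X + C (lam + 4)
    (∀ z : ℂ, z.re = 0 → ¬ p.IsRoot z)
    ∧ Multiset.card (p.roots.filter (fun z => 0 < z.re)) = 2
    ∧ Multiset.card (p.roots.filter (fun z => z.re < 0)) = 2 := by
  intro p
  have heval : ∀ y : ℝ, 0 < (p.eval (Complex.I * y)).re := by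
    intro y
    have e : p.eval (Complex.I * y) =
        ((ε ^ 2 * y ^ 4 + 5 / 12 * y ^ 2 : ℝ) : ℂ) - (c * y : ℝ) * Complex.I + (lam + 4) := by
      simp only [p, eval_add, eval_sub, eval_mul, eval_C, eval_pow, eval_X, mul_pow,
        Complex.I_sq, Complex.I_pow_four]
      push_cast; ring
    rw [e]
    simp only [Complex.add_re, Complex.sub_re, Complex.ofReal_re, Complex.re_ofReal_mul,
      Complex.I_re, Complex.re_ofNat]
    have : 0 ≤ ε ^ 2 * y ^ 4 + 5 / 12 * y ^ 2 := by positivity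
    linarith
  have hroot : ∀ z : ℂ, z.re = 0 → ¬ p.IsRoot z := by
    intro z hz hr
    have hzI : z = Complex.I * z.im := by apply Complex.ext <;> simp [hz]
    have h := heval z.im
    rw [← hzI, hr.eq_zero] at h
    exact lt_irrefl _ h
  have hε' : (ε : ℂ) ^ 2 ≠ 0 := pow_ne_zero _ (Complex.ofReal_ne_zero.2 hε.ne')
  have hdeg : p.natDegree = 4 := by
    simp only [p]; compute_degree!
    exact hε.ne'
  have hlead : p.leadingCoeff = (ε : ℂ) ^ 2 := by
    rw [leadingCoeff, hdeg]
    simp [p, -map_pow]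
  have hsplit : p.Splits := IsAlgClosed.splits p
  refine ⟨hroot, card_filter_re_of_re_prod_pos (hsplit.natDegree_eq_card_roots.symm.trans hdeg)
    (fun r hr h => hroot r h (isRoot_of_mem_roots hr)) fun y => ?_⟩
  have h := heval y
  rw [hsplit.eval_eq_prod_roots, hlead, ← Complex.ofReal_pow, Complex.re_ofReal_mul] at h
  exact pos_of_mul_pos_right h (sq_nonneg ε)
end

section
/- Let ε > 0, let 0 < γ < π/2, and let θ ∈ ℝ with |θ| ≤ π − γ. Then every complex root μ of the polynomial ε²X⁴ + e^{iθ} satisfies |Re μ| ≥ sin(γ/4)/√ε > 0, and exactly two of the four roots (counted with multiplicity) have positive real part. -/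
open Polynomial Complex

theorem roots_C_mul_X_pow_four_add_C {c d a : ℂ} (hc : c ≠ 0) (h : c * a ^ 4 = -d) :
    (C c * X ^ 4 + C d : ℂ[X]).roots = {a, -a, I * a, -(I * a)} := by
  have hd : d = -(c * a ^ 4) := by rw [h, neg_neg]
  have hI : (C I : ℂ[X]) ^ 2 = -1 := by rw [← C_pow, I_sq, C_neg, C_1]
  have hp : (C c * X ^ 4 + C d : ℂ[X]) =
      C c * (({a, -a, I * a, -(I * a)} : Multiset ℂ).map fun z => X - C z).prod := by
    simp only [Multiset.insert_eq_cons, Multiset.map_cons, Multiset.prod_cons,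
      Multiset.map_singleton, Multiset.prod_singleton, hd, C_neg, C_mul, C_pow]
    linear_combination (C c * C a ^ 2 * (X ^ 2 - C a ^ 2)) * hI
  rw [hp, roots_C_mul _ hc, roots_multiset_prod_X_sub_C]

open scoped Classical in
/-- Uniform sectoriality estimate: for `0 < γ < π/2` and `|θ| ≤ π − γ`, every
root `μ` of `ε²X⁴ + e^{iθ}` satisfies `|Re μ| ≥ sin(γ/4)/√ε > 0`, and exactly
two of the four roots (with multiplicity) have positive real part. -/
theorem sector_roots_uniformly_separated (ε γ θ : ℝ) (hε : 0 < ε)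
    (hγ₀ : 0 < γ) (hγ₁ : γ < Real.pi / 2) (hθ : |θ| ≤ Real.pi - γ) :
    let p : Polynomial ℂ := C ((ε : ℂ)^2) * X^4 + C (Complex.exp (θ * I))
    (0 < Real.sin (γ/4) / Real.sqrt ε)
    ∧ (∀ μ : ℂ, p.IsRoot μ → Real.sin (γ/4) / Real.sqrt ε ≤ |μ.re|)
    ∧ Multiset.card (p.roots.filter (fun z => 0 < z.re)) = 2 := by
  intro p
  obtain ⟨hθ₁, hθ₂⟩ := abs_le.mp hθ
  have hs : 0 < Real.sqrt ε := Real.sqrt_pos.mpr hε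
  have hpos : 0 < Real.sin (γ / 4) / Real.sqrt ε :=
    div_pos (Real.sin_pos_of_pos_of_lt_pi (by linarith) (by linarith)) hs
  set α : ℝ := (θ + Real.pi) / 4 with hα
  have hsin : Real.sin (γ / 4) / Real.sqrt ε ≤ Real.sin α / Real.sqrt ε := by
    gcongr
    exact Real.sin_le_sin_of_le_of_le_pi_div_two (by linarith) (by linarith) (by linarith)
  have hcos : Real.sin (γ / 4) / Real.sqrt ε ≤ Real.cos α / Real.sqrt ε := by
    gcongr
    rw [← Real.sin_pi_div_two_sub]
    exact Real.sin_le_sin_of_le_of_le_pi_div_two (by linarith) (by linarith) (by linarith)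
  set a : ℂ := exp (α * I) / (Real.sqrt ε : ℝ) with ha
  have ha_re : a.re = Real.cos α / Real.sqrt ε := by
    rw [ha, div_ofReal_re, exp_ofReal_mul_I_re]
  have ha_im : a.im = Real.sin α / Real.sqrt ε := by
    rw [ha, div_ofReal_im, exp_ofReal_mul_I_im]
  have hεC : (ε : ℂ) ≠ 0 := ofReal_ne_zero.mpr hε.ne'
  have hsqrt : ((Real.sqrt ε : ℝ) : ℂ) ^ 4 = (ε : ℂ) ^ 2 := by
    rw [show 4 = 2 * 2 from rfl, pow_mul, ← ofReal_pow, Real.sq_sqrt hε.le]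
  have hexp : exp (α * I) ^ 4 = -exp (θ * I) := by
    rw [← exp_nat_mul, ← exp_add_pi_mul_I]
    congr 1
    rw [hα]
    push_cast
    ring
  have ha4 : (ε : ℂ) ^ 2 * a ^ 4 = -exp (θ * I) := by
    rw [ha, div_pow, hsqrt, hexp, mul_div_cancel₀ _ (pow_ne_zero 2 hεC)]
  have hroots : p.roots = {a, -a, I * a, -(I * a)} :=
    roots_C_mul_X_pow_four_add_C (pow_ne_zero 2 hεC) ha4
  have hre : 0 < a.re := by linarith
  have him : 0 < a.im := by linarith
  refine ⟨hpos, fun μ hμ => ?_, ?_⟩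
  · have hp : p ≠ 0 := by
      rintro h
      simp [h] at hroots
    have hmem : μ ∈ p.roots := (mem_roots hp).mpr hμ
    rw [hroots] at hmem
    simp only [Multiset.insert_eq_cons, Multiset.mem_cons, Multiset.mem_singleton] at hmem
    rcases hmem with rfl | rfl | rfl | rfl <;>
      simp only [neg_re, I_mul_re, abs_neg, neg_neg, abs_of_pos hre, abs_of_pos him] <;> linarith
  · rw [hroots]
    simp [Multiset.insert_eq_cons, Multiset.filter_singleton, hre, him,
      hre.le, him.le]
end
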